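/- Hom-conservativity for linear TGDs is undecidable: the set of (encodings of) tuples (T1, T2, ΣD, ΣQ), where T1, T2 are finite sets of linear TGDs and ΣD, ΣQ are finite schemas, such that T2 is ΣD,ΣQ-hom-conservative over T1, is not computable. -/

import Mathlib

set_option autoImplicit false

/-! ### Terms: constants from 𝐂 (coded `Term.const n`) and nulls from 𝐍 (coded `Term.null n`) -/

inductive Term : Type
  | const : ℕ → Term
  | null  : ℕ → Term
deriving DecidableEq

def Term.isConst : Term → Prop
  | .const _ => True
  | .null _  => False

def termEquiv : Term ≃ ℕ ⊕ ℕ where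
  toFun t := match t with
    | .const n => Sum.inl n
    | .null n  => Sum.inr n
  invFun x := match x with
    | Sum.inl n => .const n
    | Sum.inr n => .null n
  left_inv t := by cases t <;> rfl
  right_inv x := by cases x <;> rfl

instance : Primcodable Term := Primcodable.ofEquiv _ termEquiv

/-! ### Relation symbols (with arity) and schemas -/

structure RelSym : Type where
  name : ℕ
  arity : ℕ
deriving DecidableEq

def relSymEquiv : RelSym ≃ ℕ × ℕ where
  toFun r := (r.name, r.arity)
  invFun p := ⟨p.1, p.2⟩
  left_inv r := rfl
  right_inv p := rfl

instance : Primcodable RelSym := Primcodable.ofEquiv _ relSymEquiv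

/-- A schema is a set of relation symbols. -/
abbrev Schema := Set RelSym

/-! ### Facts, instances, databases -/

structure Fct : Type where
  rel : RelSym
  args : List Term
deriving DecidableEq

def fctEquiv : Fct ≃ RelSym × List Term where
  toFun f := (f.rel, f.args)
  invFun p := ⟨p.1, p.2⟩
  left_inv f := rfl
  right_inv p := rfl

instance : Primcodable Fct := Primcodable.ofEquiv _ fctEquiv

/-- A fact is well-formed if its argument tuple matches the arity of its relation symbol
(arities are ≥ 1). -/
def Fct.wf (f : Fct) : Prop := f.args.length = f.rel.arity ∧ 1 ≤ f.rel.arity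

/-- An instance is a (possibly infinite) set of facts. -/
abbrev Inst := Set Fct

/-- The active domain of an instance. -/
def adom (I : Inst) : Set Term := { t | ∃ f ∈ I, t ∈ f.args }

/-- A database: a finite instance of well-formed facts using only constants from 𝐂. -/
def IsDB (I : Inst) : Prop :=
  I.Finite ∧ ∀ f ∈ I, f.wf ∧ ∀ t ∈ f.args, t.isConst

/-- `I` is a Σ-instance. -/
def InstOver (I : Inst) (S : Schema) : Prop := ∀ f ∈ I, f.rel ∈ S ∧ f.wf

/-- `I` is a Σ-database. -/
def IsDatabase (I : Inst) (S : Schema) : Prop := IsDB I ∧ ∀ f ∈ I, f.rel ∈ S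

/-! ### Homomorphisms -/

def Fct.map (h : Term → Term) (f : Fct) : Fct := ⟨f.rel, f.args.map h⟩

/-- `h` is a Σ-homomorphism from `I` to `J`. -/
def IsHomOn (S : Schema) (h : Term → Term) (I J : Inst) : Prop :=
  ∀ f ∈ I, f.rel ∈ S → f.map h ∈ J

/-- `h` is a homomorphism from `I` to `J` (all relation symbols). -/
def IsFullHom (h : Term → Term) (I J : Inst) : Prop := ∀ f ∈ I, f.map h ∈ J

/-- `h` is database-preserving: it is the identity on all constants from 𝐂. -/
def DBPres (h : Term → Term) : Prop := ∀ n : ℕ, h (Term.const n) = Term.const n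

/-- `I →_Σ J`: there is a database-preserving Σ-homomorphism from `I` to `J`. -/
def HomTo (S : Schema) (I J : Inst) : Prop := ∃ h, DBPres h ∧ IsHomOn S h I J

/-- The induced subinstance of `I` on a set `A` of terms. -/
def restrict (I : Inst) (A : Set Term) : Inst := { f | f ∈ I ∧ ∀ t ∈ f.args, t ∈ A }

/-- `I →ⁿ_Σ J`: every induced subinstance of `I` with at most `n` active-domain elements
admits a database-preserving Σ-homomorphism to `J`. -/
def HomN (S : Schema) (n : ℕ) (I J : Inst) : Prop :=
  ∀ A : Set Term, A ⊆ adom I → A.Finite → A.ncard ≤ n → HomTo S (restrict I A) J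

/-- `I →^lim_Σ J`. -/
def HomLim (S : Schema) (I J : Inst) : Prop := ∀ n : ℕ, 1 ≤ n → HomN S n I J

/-- Homomorphic equivalence of instances. -/
def HomEquiv (I J : Inst) : Prop := (∃ h, IsFullHom h I J) ∧ (∃ h, IsFullHom h J I)

/-! ### Gaifman graph and connectedness -/

def coOccur (I : Inst) (a b : Term) : Prop := ∃ f ∈ I, a ∈ f.args ∧ b ∈ f.args

/-- The Gaifman graph of `I` is connected. -/
def Connected (I : Inst) : Prop :=
  ∀ a ∈ adom I, ∀ b ∈ adom I, Relation.ReflTransGen (coOccur I) a b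

/-- Restriction `I|_Σ` of `I` to the facts using a relation symbol from Σ. -/
def restrS (I : Inst) (S : Schema) : Inst := { f | f ∈ I ∧ f.rel ∈ S }

/-- `I` is Σ-connected. -/
def SConnected (S : Schema) (I : Inst) : Prop := Connected (restrS I S)

/-- `C` is a maximally Σ-connected component of `I`. -/
def MaxConnComp (S : Schema) (I C : Inst) : Prop :=
  C ⊆ restrS I S ∧ Connected C ∧
    ∀ C', C ⊆ C' → C' ⊆ restrS I S → Connected C' → C' = C

/-! ### Conjunctive queries -/

structure Atom : Type where
  rel : RelSym
  args : List ℕ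
deriving DecidableEq

def atomEquiv : Atom ≃ RelSym × List ℕ where
  toFun a := (a.rel, a.args)
  invFun p := ⟨p.1, p.2⟩
  left_inv a := rfl
  right_inv p := rfl

instance : Primcodable Atom := Primcodable.ofEquiv _ atomEquiv

def Atom.wf (a : Atom) : Prop := a.args.length = a.rel.arity ∧ 1 ≤ a.rel.arity

/-- Instantiate an atom by an assignment of terms to variables. -/
def Atom.inst (h : ℕ → Term) (a : Atom) : Fct := ⟨a.rel, a.args.map h⟩

/-- A conjunctive query: a finite set of relational atoms (as a list) together with a
tuple of answer variables. -/
structure CQ : Type where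
  atoms : List Atom
  ans : List ℕ
deriving DecidableEq

def cqEquiv : CQ ≃ List Atom × List ℕ where
  toFun q := (q.atoms, q.ans)
  invFun p := ⟨p.1, p.2⟩
  left_inv q := rfl
  right_inv p := rfl

instance : Primcodable CQ := Primcodable.ofEquiv _ cqEquiv

/-- `q` is a CQ over schema Σ. -/
def CQ.Over (q : CQ) (S : Schema) : Prop := ∀ a ∈ q.atoms, a.rel ∈ S ∧ a.wf

/-- A homomorphism from `q` to `I`. -/
def CQHom (q : CQ) (I : Inst) (h : ℕ → Term) : Prop := ∀ a ∈ q.atoms, a.inst h ∈ I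

/-- `c̄` is an answer to `q` on `I`. -/
def IsAnswer (q : CQ) (I : Inst) (c : List Term) : Prop :=
  (∀ x ∈ c, x ∈ adom I) ∧ ∃ h, CQHom q I h ∧ q.ans.map h = c

/-- The canonical database of a CQ (variables viewed as constants/nulls). -/
def canonDB (q : CQ) : Inst := { f | ∃ a ∈ q.atoms, f = a.inst Term.null }

/-! ### Tuple-generating dependencies -/

/-- A TGD `∀x̄∀ȳ (φ(x̄,ȳ) → ∃z̄ ψ(x̄,z̄))`, with `frontier` the tuple `x̄` of
frontier variables. -/
structure TGD : Type where
  body : List Atom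
  head : List Atom
  frontier : List ℕ
deriving DecidableEq

def tgdEquiv : TGD ≃ List Atom × List Atom × List ℕ where
  toFun t := (t.body, t.head, t.frontier)
  invFun p := ⟨p.1, p.2.1, p.2.2⟩
  left_inv t := rfl
  right_inv p := rfl

instance : Primcodable TGD := Primcodable.ofEquiv _ tgdEquiv

def TGD.bodyVars (t : TGD) : Set ℕ := { x | ∃ a ∈ t.body, x ∈ a.args }
def TGD.headVars (t : TGD) : Set ℕ := { x | ∃ a ∈ t.head, x ∈ a.args }

/-- Well-formedness of a TGD: atoms are well-formed, the frontier variables are distinct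
body variables, and every variable shared by body and head is a frontier variable. -/
def TGD.wf (t : TGD) : Prop :=
  (∀ a ∈ t.body, a.wf) ∧ (∀ a ∈ t.head, a.wf) ∧ t.frontier.Nodup ∧
  (∀ x ∈ t.frontier, x ∈ t.bodyVars) ∧
  (∀ x, x ∈ t.bodyVars → x ∈ t.headVars → x ∈ t.frontier)

/-- A TGD is linear if its body contains at most one atom. -/
def TGD.Linear (t : TGD) : Prop := t.body.length ≤ 1

/-- A TGD is guarded if some body atom contains all body variables. -/
def TGD.Guarded (t : TGD) : Prop := ∃ a ∈ t.body, ∀ x, x ∈ t.bodyVars → x ∈ a.args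

/-- A TGD is frontier-one if it has exactly one frontier variable. -/
def TGD.FrontierOne (t : TGD) : Prop := t.frontier.length = 1

/-- `I ⊨ ϑ`. -/
def TGD.Satisfies (I : Inst) (t : TGD) : Prop :=
  ∀ g : ℕ → Term, (∀ a ∈ t.body, a.inst g ∈ I) →
    ∃ h : ℕ → Term, (∀ a ∈ t.head, a.inst h ∈ I) ∧ ∀ x ∈ t.frontier, h x = g x

/-- `I` is a model of the set `T` of TGDs. -/
def IsModel (I : Inst) (T : List TGD) : Prop := ∀ t ∈ T, TGD.Satisfies I t

/-- Number of (distinct) variables in the body of a TGD. -/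
def TGD.bodyVarList (t : TGD) : List ℕ := ((t.body.map Atom.args).flatten).dedup

/-- The body width of a set of TGDs. -/
def bodyWidth (T : List TGD) : ℕ := (T.map (fun t => t.bodyVarList.length)).foldr max 0

/-! ### The chase -/

/-- `ϑ` is applicable at tuple `c̄` in `I`. -/
def TGD.Applicable (t : TGD) (I : Inst) (c : List Term) : Prop :=
  (∃ g : ℕ → Term, (∀ a ∈ t.body, a.inst g ∈ I) ∧ t.frontier.map g = c) ∧
  ¬ (∃ h : ℕ → Term, (∀ a ∈ t.head, a.inst h ∈ I) ∧ t.frontier.map h = c)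

/-- `J` is the result of applying `ϑ` in `I` at `c̄`: the head is added, with the
existential variables replaced by distinct fresh nulls. -/
def TGD.StepResult (t : TGD) (I : Inst) (c : List Term) (J : Inst) : Prop :=
  ∃ h : ℕ → Term,
    t.frontier.map h = c ∧
    (∀ x, x ∈ t.headVars → x ∉ t.frontier → (¬ (h x).isConst ∧ h x ∉ adom I)) ∧
    (∀ x y, x ∈ t.headVars → y ∈ t.headVars → x ∉ t.frontier → y ∉ t.frontier →
      h x = h y → x = y) ∧
    J = I ∪ { f | ∃ a ∈ t.head, f = a.inst h }

/-- A chase step from `I` to `J` with some TGD of `T`. -/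
def ChaseStep (T : List TGD) (I J : Inst) : Prop :=
  ∃ t ∈ T, ∃ c, t.Applicable I c ∧ t.StepResult I c J

/-- A chase sequence for `I` with `T` (stalling when no TGD is applicable). -/
def IsChaseSeq (T : List TGD) (I : Inst) (f : ℕ → Inst) : Prop :=
  f 0 = I ∧ ∀ i, ChaseStep T (f i) (f (i+1)) ∨ ((¬ ∃ J, ChaseStep T (f i) J) ∧ f (i+1) = f i)

/-- Fairness: every applicable TGD application is eventually performed or becomes
non-applicable. -/
def IsFair (T : List TGD) (f : ℕ → Inst) : Prop :=
  ∀ i, ∀ t ∈ T, ∀ c, TGD.Applicable t (f i) c →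
    ∃ j, i ≤ j ∧
      ((TGD.Applicable t (f j) c ∧ TGD.StepResult t (f j) c (f (j+1))) ∨
        ¬ TGD.Applicable t (f j) c)

/-- `J` is the result of some fair chase sequence for `I` with `T`. -/
def IsChaseResult (T : List TGD) (I J : Inst) : Prop :=
  ∃ f : ℕ → Inst, IsChaseSeq T I f ∧ IsFair T f ∧ J = ⋃ i, f i

/-- `chase T I`: the result of an arbitrary but fixed fair chase sequence for `I` with `T`. -/
noncomputable def chase (T : List TGD) (I : Inst) : Inst :=
  @dite _ (∃ J, IsChaseResult T I J) (Classical.dec _) (fun h => h.choose) (fun _ => I)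

/-! ### Query answering w.r.t. TGDs and conservativity notions -/

/-- `c̄ ∈ q_T(D)`: `c̄` is a tuple over `adom D` and an answer to `q` on `chase T D`. -/
def AnswerWrt (q : CQ) (T : List TGD) (D : Inst) (c : List Term) : Prop :=
  (∀ x ∈ c, x ∈ adom D) ∧ ∃ h, CQHom q (chase T D) h ∧ q.ans.map h = c

/-- `T2` is `ΣD,ΣQ`-hom-conservative over `T1`. -/
def HomConservative (T1 T2 : List TGD) (SD SQ : Schema) : Prop :=
  ∀ D, IsDatabase D SD → HomTo SQ (chase T2 D) (chase T1 D)

/-- `T2` is `ΣD,ΣQ`-CQ-conservative over `T1`. -/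
def CQConservative (T1 T2 : List TGD) (SD SQ : Schema) : Prop :=
  ∀ D, IsDatabase D SD → ∀ q : CQ, CQ.Over q SQ →
    ∀ c, AnswerWrt q T2 D c → AnswerWrt q T1 D c

/-- `T` is `ΣD,ΣQ`-hom-trivial. -/
def HomTrivial (T : List TGD) (SD SQ : Schema) : Prop :=
  ∀ D, IsDatabase D SD → HomTo SQ (chase T D) D

/-- `T` is `ΣD,ΣQ`-CQ-trivial. -/
def CQTrivial (T : List TGD) (SD SQ : Schema) : Prop :=
  ∀ D, IsDatabase D SD → ∀ q : CQ, CQ.Over q SQ →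
    ∀ c, AnswerWrt q T D c → IsAnswer q D c

/-! ### Existence and universality of the chase -/

theorem Atom.inst_congr {a : Atom} {g h : ℕ → Term} (H : ∀ x ∈ a.args, g x = h x) :
    a.inst g = a.inst h := by
  simp only [Atom.inst, Fct.mk.injEq, true_and]
  exact List.map_congr_left H

theorem Atom.map_inst (a : Atom) (g : ℕ → Term) (h : Term → Term) :
    (a.inst g).map h = a.inst (h ∘ g) := by
  simp [Atom.inst, Fct.map]

theorem Fct.map_congr {f : Fct} {g h : Term → Term} (H : ∀ x ∈ f.args, g x = h x) :
    f.map g = f.map h := by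
  simp only [Fct.map, Fct.mk.injEq, true_and]
  exact List.map_congr_left H

theorem adom_mono {I J : Inst} (h : I ⊆ J) : adom I ⊆ adom J :=
  fun _ ⟨f, hf, ht⟩ => ⟨f, h hf, ht⟩

theorem adom_finite {I : Inst} (hI : I.Finite) : (adom I).Finite := by
  have : adom I = ⋃ f ∈ I, {t | t ∈ f.args} := by ext; simp [adom]
  rw [this]
  exact hI.biUnion fun f _ => List.finite_toSet f.args

theorem TGD.StepResult.subset {t : TGD} {I J : Inst} {c : List Term} (h : t.StepResult I c J) :
    I ⊆ J := by
  obtain ⟨_, _, _, _, rfl⟩ := h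
  exact Set.subset_union_left

theorem TGD.StepResult.finite {t : TGD} {I J : Inst} {c : List Term} (h : t.StepResult I c J)
    (hI : I.Finite) : J.Finite := by
  obtain ⟨g, _, _, _, rfl⟩ := h
  refine hI.union (((List.finite_toSet t.head).image (Atom.inst g)).subset ?_)
  rintro _ ⟨a, ha, rfl⟩
  exact ⟨a, ha, rfl⟩

theorem TGD.StepResult.not_applicable {t : TGD} {I J K : Inst} {c : List Term}
    (h : t.StepResult I c J) (hJK : J ⊆ K) : ¬ t.Applicable K c := by
  obtain ⟨g, hg, _, _, rfl⟩ := h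
  exact fun hA => hA.2 ⟨g, fun a ha => hJK (Or.inr ⟨a, ha, rfl⟩), hg⟩

theorem TGD.Applicable.exists_stepResult {t : TGD} {I : Inst} {c : List Term}
    (h : t.Applicable I c) (hI : I.Finite) : ∃ J, t.StepResult I c J := by
  classical
  obtain ⟨⟨g, _, hg⟩, _⟩ := h
  obtain ⟨N, hN⟩ : ∃ N, ∀ n, N ≤ n → Term.null n ∉ adom I := by
    have hinj : Function.Injective Term.null := fun _ _ h => by simpa using h
    obtain ⟨N, hN⟩ := ((adom_finite hI).preimage hinj.injOn).bddAbove
    exact ⟨N + 1, fun n hn hmem => absurd (hN hmem) (by omega)⟩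
  refine ⟨_, fun x => if x ∈ t.frontier then g x else Term.null (N + x), ?_, ?_, ?_, rfl⟩
  · rw [← hg]
    exact List.map_congr_left fun x hx => by simp [hx]
  · intro x _ hx
    simpa [hx, Term.isConst] using hN _ (Nat.le_add_right N x)
  · intro x y _ _ hx hy hxy
    simpa [hx, hy] using hxy

/-- `J` results from `I` by applying the TGD of `T` at the tuple, the two having code `k`. -/
def CodedStep (T : List TGD) (I : Inst) (k : ℕ) (J : Inst) : Prop :=
  ∃ t ∈ T, ∃ c, Encodable.encode (t, c) = k ∧ t.Applicable I c ∧ t.StepResult I c J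

/-- Perform the applicable step of least code, if there is one. -/
theorem exists_least_step (T : List TGD) (I : Inst) (hI : I.Finite) :
    ∃ J : Inst, J.Finite ∧ I ⊆ J ∧
      ((∃ k, CodedStep T I k J ∧ ∀ t ∈ T, ∀ c, t.Applicable I c → k ≤ Encodable.encode (t, c)) ∨
        ((¬ ∃ J', ChaseStep T I J') ∧ J = I)) := by
  classical
  by_cases h : ∃ k J, CodedStep T I k J
  · obtain ⟨J, hJ⟩ := Nat.find_spec h
    have hJ' := hJ
    obtain ⟨t, _, c, _, _, hs⟩ := hJ'
    refine ⟨J, hs.finite hI, hs.subset, Or.inl ⟨_, hJ, fun t ht c hA => ?_⟩⟩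
    obtain ⟨J', hJ'⟩ := hA.exists_stepResult hI
    exact Nat.find_min' h ⟨J', t, ht, c, rfl, hA, hJ'⟩
  · refine ⟨I, hI, subset_rfl, Or.inr ⟨?_, rfl⟩⟩
    rintro ⟨J, t, ht, c, hA, hs⟩
    exact h ⟨_, J, t, ht, c, rfl, hA, hs⟩

theorem exists_isChaseResult (T : List TGD) (I : Inst) (hI : I.Finite) :
    ∃ J, IsChaseResult T I J := by
  choose! next hfin hsub hnext using exists_least_step T
  let f : ℕ → Inst := fun n => next^[n] I
  have hf1 : ∀ n, f (n + 1) = next (f n) := fun n => Function.iterate_succ_apply' next n I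
  have hf : ∀ n, (f n).Finite := by
    intro n
    induction n with
    | zero => exact hI
    | succ n ih => rw [hf1]; exact hfin _ ih
  have hmono : Monotone f := monotone_nat_of_le_succ fun n => by rw [hf1]; exact hsub _ (hf n)
  refine ⟨_, f, ⟨rfl, fun i => ?_⟩, ?_, rfl⟩
  · rw [hf1]
    rcases hnext _ (hf i) with ⟨k, ⟨t, ht, c, -, hA, hs⟩, -⟩ | h
    · exact Or.inl ⟨t, ht, c, hA, hs⟩
    · exact Or.inr h
  · intro i t ht c _
    by_contra! hcon
    have hstep : ∀ n, ∃ t' ∈ T, ∃ c', Encodable.encode (t', c') < Encodable.encode (t, c) ∧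
        t'.Applicable (f (i + n)) c' ∧ t'.StepResult (f (i + n)) c' (f (i + n + 1)) := by
      intro n
      obtain ⟨hnot, happ⟩ := hcon (i + n) (Nat.le_add_right _ _)
      rcases hnext _ (hf (i + n)) with ⟨k, ⟨t', ht', c', rfl, hA, hs⟩, hmin⟩ | ⟨hno, -⟩
      · rw [← hf1] at hs
        refine ⟨t', ht', c', lt_of_le_of_ne (hmin t ht c happ) fun he => ?_, hA, hs⟩
        obtain ⟨rfl, rfl⟩ := Prod.mk.inj (Encodable.encode_injective he)
        exact hnot happ hs
      · obtain ⟨J, hJ⟩ := happ.exists_stepResult (hf (i + n))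
        exact absurd ⟨J, t, ht, c, happ, hJ⟩ hno
    choose t' _ c' hlt hA hs using hstep
    have hne : ∀ m n, m < n →
        Encodable.encode (t' m, c' m) ≠ Encodable.encode (t' n, c' n) := by
      intro m n hmn he
      obtain ⟨h1, h2⟩ := Prod.mk.inj (Encodable.encode_injective he)
      have := (hs m).not_applicable (K := f (i + n)) (hmono (by omega))
      rw [h1, h2] at this
      exact this (hA n)
    have hinj : Function.Injective fun n => Encodable.encode (t' n, c' n) := by
      intro m n he
      rcases lt_trichotomy m n with h | h | h
      · exact absurd he (hne m n h)
      · exact h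
      · exact absurd he.symm (hne n m h)
    exact Set.infinite_range_of_injective hinj
      ((Set.finite_lt_nat (Encodable.encode (t, c))).subset
        (by rintro _ ⟨n, rfl⟩; exact hlt n))

theorem IsChaseSeq.monotone {T : List TGD} {I : Inst} {f : ℕ → Inst} (h : IsChaseSeq T I f) :
    Monotone f := by
  refine monotone_nat_of_le_succ fun n => ?_
  rcases h.2 n with ⟨t, _, c, _, hs⟩ | ⟨_, he⟩
  · exact hs.subset
  · exact he.ge

theorem exists_stage {f : ℕ → Inst} (hf : Monotone f) (l : List Atom) (g : ℕ → Term)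
    (h : ∀ a ∈ l, a.inst g ∈ ⋃ i, f i) : ∃ i, ∀ a ∈ l, a.inst g ∈ f i := by
  induction l with
  | nil => exact ⟨0, by simp⟩
  | cons b l ih =>
    obtain ⟨i, hi⟩ := ih fun a ha => h a (List.mem_cons_of_mem _ ha)
    obtain ⟨j, hj⟩ := Set.mem_iUnion.1 (h b List.mem_cons_self)
    refine ⟨max i j, fun a ha => ?_⟩
    rcases List.mem_cons.1 ha with rfl | ha
    · exact hf (le_max_right i j) hj
    · exact hf (le_max_left i j) (hi a ha)

theorem IsChaseResult.isModel {T : List TGD} {I J : Inst} (h : IsChaseResult T I J) :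
    IsModel J T := by
  obtain ⟨f, hseq, hfair, rfl⟩ := h
  intro t ht g hg
  have hmono := hseq.monotone
  obtain ⟨i, hi⟩ := exists_stage hmono t.body g hg
  suffices ∃ j, ∃ h : ℕ → Term, (∀ a ∈ t.head, a.inst h ∈ f j) ∧
      t.frontier.map h = t.frontier.map g by
    obtain ⟨j, h, hh, hfr⟩ := this
    exact ⟨h, fun a ha => Set.mem_iUnion.2 ⟨j, hh a ha⟩, List.map_inj_left.1 hfr⟩
  by_contra! hcon
  have happ : ∀ j, i ≤ j → t.Applicable (f j) (t.frontier.map g) := fun j hij =>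
    ⟨⟨g, fun a ha => hmono hij (hi a ha), rfl⟩, fun ⟨h, hh, hfr⟩ => hcon j h hh hfr⟩
  obtain ⟨j, hij, ⟨-, hs⟩ | hna⟩ := hfair i t ht _ (happ i le_rfl)
  · exact hs.not_applicable le_rfl (happ (j + 1) (by omega))
  · exact hna (happ j hij)

theorem TGD.StepResult.extend_hom {t : TGD} (hwf : t.wf) {I J M : Inst} {c : List Term}
    (hA : t.Applicable I c) (hs : t.StepResult I c J) (hM : TGD.Satisfies M t)
    {h : Term → Term} (hdb : DBPres h) (hh : IsFullHom h I M) :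
    ∃ h', (DBPres h' ∧ IsFullHom h' J M) ∧ ∀ x ∈ adom I, h' x = h x := by
  classical
  obtain ⟨⟨g, hg, rfl⟩, -⟩ := hA
  obtain ⟨e, he, hfresh, hinj, rfl⟩ := hs
  have he' := List.map_inj_left.1 he
  obtain ⟨u, hu, hug⟩ := hM (h ∘ g) fun a ha => by
    rw [← Atom.map_inst]; exact hh _ (hg a ha)
  let P : Term → ℕ → Prop := fun y x => x ∈ t.headVars ∧ x ∉ t.frontier ∧ e x = y
  let h' : Term → Term := fun y => if H : ∃ x, P y x then u H.choose else h y
  have hold : ∀ y, (y.isConst ∨ y ∈ adom I) → h' y = h y := by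
    intro y hy
    refine dif_neg ?_
    rintro ⟨x, hx, hxf, rfl⟩
    have := hfresh x hx hxf
    tauto
  have hI : ∀ x ∈ adom I, h' x = h x := fun x hx => hold x (Or.inr hx)
  refine ⟨h', ⟨fun n => ?_, ?_⟩, hI⟩
  · rw [hold (Term.const n) (Or.inl trivial), hdb]
  · rintro f (hf | ⟨a, ha, rfl⟩)
    · rw [Fct.map_congr fun x hx => hI x ⟨f, hf, hx⟩]
      exact hh f hf
    · rw [Atom.map_inst, Atom.inst_congr (h := u)]
      · exact hu a ha
      · intro x hx
        by_cases hxf : x ∈ t.frontier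
        · obtain ⟨b, hb, hxb⟩ := hwf.2.2.2.1 x hxf
          have : g x ∈ adom I := ⟨_, hg b hb, List.mem_map_of_mem hxb⟩
          rw [Function.comp_apply, he' x hxf, hI _ this, hug x hxf, Function.comp_apply]
        · have H : ∃ z, P (e x) z := ⟨x, ⟨a, ha, hx⟩, hxf, rfl⟩
          have h1 : h' (e x) = u H.choose := dif_pos H
          obtain ⟨hz, hzf, hze⟩ := H.choose_spec
          rw [Function.comp_apply, h1, hinj _ _ hz ⟨a, ha, hx⟩ hzf hxf hze]

theorem IsChaseResult.exists_hom {T : List TGD} (hT : ∀ t ∈ T, t.wf) {I J M : Inst}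
    (h : IsChaseResult T I J) (hM : IsModel M T) (hIM : I ⊆ M) :
    ∃ h, DBPres h ∧ IsFullHom h J M := by
  classical
  obtain ⟨f, hseq, -, rfl⟩ := h
  have hmono := hseq.monotone
  have hstep : ∀ i h, DBPres h ∧ IsFullHom h (f i) M →
      ∃ h', (DBPres h' ∧ IsFullHom h' (f (i + 1)) M) ∧ ∀ x ∈ adom (f i), h' x = h x := by
    rintro i h ⟨hdb, hh⟩
    rcases hseq.2 i with ⟨t, ht, c, hA, hs⟩ | ⟨-, he⟩
    · exact hs.extend_hom (hT t ht) hA (hM t ht) hdb hh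
    · exact ⟨h, ⟨hdb, he ▸ hh⟩, fun _ _ => rfl⟩
  choose! nxt hnxt hagree using hstep
  let G : ℕ → Term → Term := fun n => Nat.rec id nxt n
  have hG : ∀ n, DBPres (G n) ∧ IsFullHom (G n) (f n) M := by
    intro n
    induction n with
    | zero => exact ⟨fun _ => rfl, fun a ha => by
        rw [hseq.1] at ha; simpa [G, Fct.map] using hIM ha⟩
    | succ n ih => exact hnxt n _ ih
  have hstab : ∀ i j, i ≤ j → ∀ x ∈ adom (f i), G j x = G i x := by
    intro i j hij x hx
    induction j, hij using Nat.le_induction with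
    | base => rfl
    | succ j hij ih =>
      rw [← ih]
      exact hagree j _ (hG j) x (adom_mono (hmono hij) hx)
  let h : Term → Term := fun x => if H : ∃ i, x ∈ adom (f i) then G (Nat.find H) x else x
  have hh : ∀ i, ∀ x ∈ adom (f i), h x = G i x := by
    intro i x hx
    have H : ∃ i, x ∈ adom (f i) := ⟨i, hx⟩
    rw [show h x = _ from dif_pos H]
    exact (hstab _ _ (Nat.find_min' H hx) x (Nat.find_spec H)).symm
  refine ⟨h, fun n => ?_, fun a ha => ?_⟩
  · by_cases H : ∃ i, Term.const n ∈ adom (f i)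
    · obtain ⟨i, hi⟩ := H
      rw [hh i _ hi, (hG i).1]
    · exact dif_neg H
  · obtain ⟨i, hi⟩ := Set.mem_iUnion.1 ha
    rw [Fct.map_congr fun x hx => hh i x ⟨a, hi, hx⟩]
    exact (hG i).2 a hi

theorem chase_isChaseResult (T : List TGD) {I : Inst} (hI : I.Finite) :
    IsChaseResult T I (chase T I) := by
  have H := exists_isChaseResult T I hI
  unfold chase
  rw [dif_pos H]
  exact H.choose_spec

/-! ### Stack systems: nondeterministic automata with four stacks over four letters -/

namespace StackSystem

/-- Operations on a stack: leave it unchanged, testing its top, or push or pop a letter. -/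
inductive Op (Γ : Type) : Type
  | same : Option Γ → Op Γ
  | push : Γ → Op Γ
  | pop : Γ → Op Γ

/-- The relation between stack contents defined by an operation. -/
def Op.rel {Γ : Type} : Op Γ → List Γ → List Γ → Prop
  | .same o, w, w' => w' = w ∧ w.head? = o
  | .push a, w, w' => w' = a :: w
  | .pop a, w, w' => w = a :: w'

/-- `(k, q, q', op)`: moving from state `q` to `q'`, the operation `op` may be applied to stack
`k`. -/
abbrev Rule (m : ℕ) : Type := Fin 4 × Fin m × Fin m × Op (Fin 4)

abbrev Config (m : ℕ) : Type := Fin m × (Fin 4 → List (Fin 4))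

variable {m : ℕ}

/-- A step of a stack system applies an admissible operation to every stack. -/
def Step (rules : List (Rule m)) (c c' : Config m) : Prop :=
  ∀ k, ∃ op, (k, c.1, c'.1, op) ∈ rules ∧ op.rel (c.2 k) (c'.2 k)

/-- There is an infinite run from `c`, expressed through a set of configurations closed under
taking some successor. -/
def HasInfiniteRun (rules : List (Rule m)) (c : Config m) : Prop :=
  ∃ X : Set (Config m), c ∈ X ∧ ∀ d ∈ X, ∃ d' ∈ X, Step rules d d'

def initStacks (w : List (Fin 4)) (k : Fin 4) : List (Fin 4) := if k = 0 then w else []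

/-! ### The relation symbols of the reduction -/

def nodeSym (m : ℕ) : RelSym := ⟨0, m + 1⟩
def startSym : RelSym := ⟨1, 1⟩
def emptySym : RelSym := ⟨2, 1⟩
def stepSym (k : Fin 4) : RelSym := ⟨3 + k, 4⟩
def consSym (a : Fin 4) : RelSym := ⟨7 + a, 2⟩
def runSym : RelSym := ⟨11, 5⟩

/-- The query schema: all symbols but `nodeSym m` and `runSym`. -/
def querySchema : List RelSym :=
  startSym :: emptySym :: ((List.finRange 4).map stepSym ++ (List.finRange 4).map consSym)

theorem mem_querySchema {r : RelSym} : r ∈ querySchema ↔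
    r = startSym ∨ r = emptySym ∨ (∃ k, r = stepSym k) ∨ ∃ a, r = consSym a := by
  simp [querySchema, eq_comm]

theorem runSym_notMem : runSym ∉ querySchema := by decide

theorem stepSym_injective : Function.Injective stepSym := by decide

theorem consSym_injective : Function.Injective consSym := by decide

/-! ### The TGDs generating the tree of stack contents -/

/-- The step atoms for a rule that become available when the node `y` is created: as the root if
`o = none`, as the child of `x` for the letter `a` if `o = some a`. -/
def ruleAtoms (o : Option (Fin 4)) (x y : ℕ) : Rule m → List Atom
  | (k, q, q', .same o') => if o' = o then [⟨stepSym k, [q, y, q', y]⟩] else []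
  | (k, q, q', .push a) => if o = some a then [⟨stepSym k, [q, x, q', y]⟩] else []
  | (k, q, q', .pop a) => if o = some a then [⟨stepSym k, [q, y, q', x]⟩] else []

def stepAtoms (rules : List (Rule m)) (o : Option (Fin 4)) (x y : ℕ) : List Atom :=
  rules.flatMap (ruleAtoms o x y)

def nodeAtom (m x : ℕ) : Atom := ⟨nodeSym m, List.range m ++ [x]⟩

def rootTGD (rules : List (Rule m)) (q₀ : Fin m) : TGD where
  body := []
  head := nodeAtom m m :: ⟨startSym, [q₀]⟩ :: ⟨emptySym, [m]⟩ :: stepAtoms rules none m m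
  frontier := []

def childTGD (rules : List (Rule m)) (a : Fin 4) : TGD where
  body := [nodeAtom m m]
  head := nodeAtom m (m + 1) :: ⟨consSym a, [m, m + 1]⟩ :: stepAtoms rules (some a) m (m + 1)
  frontier := List.range (m + 1)

def treeTGDs (rules : List (Rule m)) (q₀ : Fin m) : List TGD :=
  rootTGD rules q₀ :: (List.finRange 4).map (childTGD rules)

/-! ### The TGDs generating the run -/

/-- The atom relating the stack contents `w.drop j` and `w.drop (j + 1)`. -/
def letterAtom (w : List (Fin 4)) (j : ℕ) : Atom := ⟨consSym (w.getD j 0), [j + 2, j + 1]⟩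

/-- The start of the run; variable `j + 1` stands for the stack contents `w.drop j`. -/
def loadTGD (w : List (Fin 4)) : TGD where
  body := []
  head := ⟨startSym, [0]⟩ :: ⟨emptySym, [w.length + 1]⟩ ::
    ⟨runSym, [0, 1, w.length + 1, w.length + 1, w.length + 1]⟩ ::
    (List.range w.length).map (letterAtom w)
  frontier := []

def moveTGD : TGD where
  body := [⟨runSym, [0, 1, 2, 3, 4]⟩]
  head := ⟨runSym, [5, 6, 7, 8, 9]⟩ ::
    (List.finRange 4).map fun k => ⟨stepSym k, [0, k + 1, 5, k + 6]⟩
  frontier := List.range 5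

def runTGDs (w : List (Fin 4)) : List TGD := [loadTGD w, moveTGD]

theorem stepAtoms_wf (rules : List (Rule m)) (o : Option (Fin 4)) (x y : ℕ) :
    ∀ a ∈ stepAtoms rules o x y, a.wf := by
  intro a ha
  obtain ⟨⟨k, q, q', op⟩, -, hr⟩ := List.mem_flatMap.1 ha
  cases op <;> simp only [ruleAtoms] at hr <;> split_ifs at hr <;> simp_all [Atom.wf, stepSym]

theorem nodeAtom_wf (m x : ℕ) : (nodeAtom m x).wf := by
  simp [Atom.wf, nodeAtom, nodeSym]

theorem treeTGDs_wf (rules : List (Rule m)) (q₀ : Fin m) :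
    ∀ t ∈ treeTGDs rules q₀, t.wf ∧ t.Linear := by
  intro t ht
  rcases List.mem_cons.1 ht with rfl | ht
  · refine ⟨⟨by simp [rootTGD], ?_, by simp [rootTGD], by simp [rootTGD],
      by simp [rootTGD, TGD.bodyVars]⟩, by simp [TGD.Linear, rootTGD]⟩
    intro a ha
    simp only [rootTGD, List.mem_cons] at ha
    rcases ha with rfl | rfl | rfl | ha
    · exact nodeAtom_wf _ _
    · simp [Atom.wf, startSym]
    · simp [Atom.wf, emptySym]
    · exact stepAtoms_wf _ _ _ _ _ ha
  · obtain ⟨b, -, rfl⟩ := List.mem_map.1 ht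
    have hbody : ∀ x, x ∈ (childTGD rules b).bodyVars ↔ x ∈ List.range (m + 1) := by
      intro x
      simp [TGD.bodyVars, childTGD, nodeAtom]
      omega
    refine ⟨⟨by simpa [childTGD] using nodeAtom_wf m m, ?_, List.nodup_range,
      fun x hx => (hbody x).2 hx, fun x hx _ => (hbody x).1 hx⟩, by simp [TGD.Linear, childTGD]⟩
    intro a ha
    simp only [childTGD, List.mem_cons] at ha
    rcases ha with rfl | rfl | ha
    · exact nodeAtom_wf _ _
    · simp [Atom.wf, consSym]
    · exact stepAtoms_wf _ _ _ _ _ ha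

theorem runTGDs_wf (w : List (Fin 4)) : ∀ t ∈ runTGDs w, t.wf ∧ t.Linear := by
  intro t ht
  simp only [runTGDs, List.mem_cons, List.not_mem_nil, or_false] at ht
  rcases ht with rfl | rfl
  · refine ⟨⟨by simp [loadTGD], ?_, by simp [loadTGD], by simp [loadTGD],
      by simp [loadTGD, TGD.bodyVars]⟩, by simp [TGD.Linear, loadTGD]⟩
    intro a ha
    simp only [loadTGD, List.mem_cons, List.mem_map] at ha
    rcases ha with rfl | rfl | rfl | ⟨j, -, rfl⟩ <;>
      simp [Atom.wf, startSym, emptySym, runSym, letterAtom, consSym]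
  · have hbody : ∀ x, x ∈ moveTGD.bodyVars ↔ x ∈ List.range 5 := by
      intro x
      simp [TGD.bodyVars, moveTGD]
      omega
    refine ⟨⟨by simp [moveTGD, Atom.wf, runSym], ?_, List.nodup_range,
      fun x hx => (hbody x).2 hx, fun x hx _ => (hbody x).1 hx⟩, by simp [TGD.Linear, moveTGD]⟩
    intro a ha
    simp only [moveTGD, List.mem_cons, List.mem_map] at ha
    rcases ha with rfl | ⟨k, -, rfl⟩ <;> simp [Atom.wf, runSym, stepSym]

/-! ### The canonical model of the tree TGDs -/

def wordTerm (w : List (Fin 4)) : Term := .null (Encodable.encode w)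

theorem wordTerm_injective : Function.Injective wordTerm := fun _ _ h =>
  Encodable.encode_injective (Term.null.inj h)

/-- The model in which the states are constants and the tree nodes are all stack contents. -/
def treeModel (rules : List (Rule m)) (q₀ : Fin m) : Inst :=
  {f | (∃ w, f = ⟨nodeSym m, (List.range m).map Term.const ++ [wordTerm w]⟩) ∨
    f = ⟨startSym, [.const q₀]⟩ ∨ f = ⟨emptySym, [wordTerm []]⟩ ∨
    (∃ a w, f = ⟨consSym a, [wordTerm w, wordTerm (a :: w)]⟩) ∨
    ∃ k q q' op w w', (k, q, q', op) ∈ rules ∧ Op.rel op w w' ∧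
      f = ⟨stepSym k, [.const q, wordTerm w, .const q', wordTerm w']⟩}

theorem node_mem_treeModel {rules : List (Rule m)} {q₀ : Fin m} {l : List Term} :
    (⟨nodeSym m, l⟩ : Fct) ∈ treeModel rules q₀ ↔
      ∃ w, l = (List.range m).map Term.const ++ [wordTerm w] := by
  constructor
  · intro h
    simp only [treeModel, Set.mem_ofPred_eq, Fct.mk.injEq, nodeSym, startSym, emptySym, consSym,
      stepSym, RelSym.mk.injEq] at h
    rcases h with ⟨w, -, h⟩ | h | h | ⟨a, w, h⟩ | ⟨k, q, q', op, w, w', -, -, h⟩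
    · exact ⟨w, h⟩
    all_goals omega
  · rintro ⟨w, rfl⟩
    exact Or.inl ⟨w, rfl⟩

theorem start_mem_treeModel {rules : List (Rule m)} {q₀ : Fin m} {l : List Term} :
    (⟨startSym, l⟩ : Fct) ∈ treeModel rules q₀ ↔ l = [.const q₀] := by
  constructor
  · intro h
    simp only [treeModel, Set.mem_ofPred_eq, Fct.mk.injEq, nodeSym, startSym, emptySym, consSym,
      stepSym, RelSym.mk.injEq] at h
    rcases h with ⟨w, h⟩ | h | h | ⟨a, w, h⟩ | ⟨k, q, q', op, w, w', -, -, h⟩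
    · omega
    · exact h.2
    all_goals omega
  · rintro rfl
    exact Or.inr (Or.inl rfl)

theorem empty_mem_treeModel {rules : List (Rule m)} {q₀ : Fin m} {l : List Term} :
    (⟨emptySym, l⟩ : Fct) ∈ treeModel rules q₀ ↔ l = [wordTerm []] := by
  constructor
  · intro h
    simp only [treeModel, Set.mem_ofPred_eq, Fct.mk.injEq, nodeSym, startSym, emptySym, consSym,
      stepSym, RelSym.mk.injEq] at h
    rcases h with ⟨w, h⟩ | h | h | ⟨a, w, h⟩ | ⟨k, q, q', op, w, w', -, -, h⟩
    · omega
    · omega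
    · exact h.2
    all_goals omega
  · rintro rfl
    exact Or.inr (Or.inr (Or.inl rfl))

theorem cons_mem_treeModel {rules : List (Rule m)} {q₀ : Fin m} {a : Fin 4} {l : List Term} :
    (⟨consSym a, l⟩ : Fct) ∈ treeModel rules q₀ ↔ ∃ w, l = [wordTerm w, wordTerm (a :: w)] := by
  constructor
  · rintro (⟨w, h⟩ | h | h | ⟨b, w, h⟩ | ⟨k, q, q', op, w, w', -, -, h⟩)
    · have := congrArg (fun f => f.rel.name) h
      simp [nodeSym, consSym] at this
    · have := congrArg (fun f => f.rel.name) h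
      simp [startSym, consSym] at this
      omega
    · have := congrArg (fun f => f.rel.name) h
      simp [emptySym, consSym] at this
      omega
    · obtain ⟨h1, h2⟩ := Fct.mk.inj h
      obtain rfl := consSym_injective h1
      exact ⟨w, h2⟩
    · have := congrArg (fun f => f.rel.arity) h
      simp [stepSym, consSym] at this
  · rintro ⟨w, rfl⟩
    exact Or.inr (Or.inr (Or.inr (Or.inl ⟨a, w, rfl⟩)))

theorem step_mem_treeModel {rules : List (Rule m)} {q₀ : Fin m} {k : Fin 4} {l : List Term} :
    (⟨stepSym k, l⟩ : Fct) ∈ treeModel rules q₀ ↔ ∃ q q' op w w', (k, q, q', op) ∈ rules ∧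
      Op.rel op w w' ∧ l = [.const q, wordTerm w, .const q', wordTerm w'] := by
  constructor
  · rintro (⟨w, h⟩ | h | h | ⟨b, w, h⟩ | ⟨k', q, q', op, w, w', hr, ho, h⟩)
    · have := congrArg (fun f => f.rel.name) h
      simp [nodeSym, stepSym] at this
    · have := congrArg (fun f => f.rel.arity) h
      simp [startSym, stepSym] at this
    · have := congrArg (fun f => f.rel.arity) h
      simp [emptySym, stepSym] at this
    · have := congrArg (fun f => f.rel.arity) h
      simp [stepSym, consSym] at this
    · obtain ⟨h1, h2⟩ := Fct.mk.inj h
      obtain rfl := stepSym_injective h1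
      exact ⟨q, q', op, w, w', hr, ho, h2⟩
  · rintro ⟨q, q', op, w, w', hr, ho, rfl⟩
    exact Or.inr (Or.inr (Or.inr (Or.inr ⟨k, q, q', op, w, w', hr, ho, rfl⟩)))

/-- Interpretation of the variables of the tree TGDs: `v` for the node variable, `v'` for its
child. -/
def treeAssign (m : ℕ) (v v' : List (Fin 4)) (i : ℕ) : Term :=
  if i < m then .const i else if i = m then wordTerm v else wordTerm v'

theorem nodeAtom_inst {g : ℕ → Term} {x : ℕ} :
    (nodeAtom m x).inst g = ⟨nodeSym m, (List.range m).map g ++ [g x]⟩ := by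
  simp [nodeAtom, Atom.inst]

theorem map_treeAssign (v v' : List (Fin 4)) :
    (List.range m).map (treeAssign m v v') = (List.range m).map Term.const :=
  List.map_congr_left fun _ hi => if_pos (List.mem_range.1 hi)

theorem treeModel_isModel (rules : List (Rule m)) (q₀ : Fin m) :
    IsModel (treeModel rules q₀) (treeTGDs rules q₀) := by
  have hq : ∀ (v v' : List (Fin 4)) (q : Fin m), treeAssign m v v' q = .const q :=
    fun v v' q => if_pos q.2
  have hm : ∀ v v' : List (Fin 4), treeAssign m v v' m = wordTerm v := by simp [treeAssign]
  have hm1 : ∀ v v' : List (Fin 4), treeAssign m v v' (m + 1) = wordTerm v' := by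
    simp [treeAssign]
  intro t ht
  rcases List.mem_cons.1 ht with rfl | ht
  · intro g _
    refine ⟨treeAssign m [] [], ?_, by simp [rootTGD]⟩
    intro a ha
    simp only [rootTGD, List.mem_cons] at ha
    rcases ha with rfl | rfl | rfl | ha
    · rw [nodeAtom_inst, node_mem_treeModel, map_treeAssign, hm]
      exact ⟨_, rfl⟩
    · simp [Atom.inst, start_mem_treeModel, hq]
    · simp [Atom.inst, empty_mem_treeModel, hm]
    · obtain ⟨⟨k, q, q', op⟩, hr, ha⟩ := List.mem_flatMap.1 ha
      cases op <;> simp only [ruleAtoms] at ha <;> split_ifs at ha with ho <;>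
        simp only [List.not_mem_nil, List.mem_singleton, reduceCtorEq] at ha ho <;>
        try contradiction
      subst ha ho
      simp only [Atom.inst, step_mem_treeModel, List.map, hq, hm]
      exact ⟨_, _, _, _, _, hr, ⟨rfl, rfl⟩, rfl⟩
  · obtain ⟨b, -, rfl⟩ := List.mem_map.1 ht
    intro g hg
    have hb := hg (nodeAtom m m) (by simp [childTGD])
    rw [nodeAtom_inst, node_mem_treeModel] at hb
    obtain ⟨w, hw⟩ := hb
    obtain ⟨hs, hw⟩ := List.append_inj' hw rfl
    refine ⟨treeAssign m w (b :: w), ?_, ?_⟩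
    · intro a ha
      simp only [childTGD, List.mem_cons] at ha
      rcases ha with rfl | rfl | ha
      · rw [nodeAtom_inst, node_mem_treeModel, map_treeAssign, hm1]
        exact ⟨_, rfl⟩
      · simp only [Atom.inst, cons_mem_treeModel, List.map, hm, hm1]
        exact ⟨_, rfl⟩
      · obtain ⟨⟨k, q, q', op⟩, hr, ha⟩ := List.mem_flatMap.1 ha
        cases op <;> simp only [ruleAtoms] at ha <;> split_ifs at ha with ho <;>
          simp only [List.not_mem_nil, List.mem_singleton, Option.some.injEq] at ha ho <;>
          subst ha ho <;> simp only [Atom.inst, step_mem_treeModel, List.map, hq, hm, hm1] <;>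
          refine ⟨_, _, _, _, _, hr, ?_, rfl⟩ <;> simp [Op.rel]
    · intro x hx
      rw [show (childTGD rules b).frontier = List.range (m + 1) from rfl, List.mem_range] at hx
      rcases Nat.lt_succ_iff_lt_or_eq.1 hx with h | rfl
      · rw [List.map_inj_left.1 hs x (List.mem_range.2 h), treeAssign, if_pos h]
      · rw [hm]
        exact (List.cons.inj hw).1.symm

/-- Every model of the tree TGDs contains an image of the tree of stack contents. -/
theorem exists_tree {rules : List (Rule m)} {q₀ : Fin m} {C : Inst}
    (hC : IsModel C (treeTGDs rules q₀)) :
    ∃ (s : ℕ → Term) (el : List (Fin 4) → Term),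
      ⟨startSym, [s q₀]⟩ ∈ C ∧ ⟨emptySym, [el []]⟩ ∈ C ∧
      (∀ a w, ⟨consSym a, [el w, el (a :: w)]⟩ ∈ C) ∧
      ∀ k q q' op w w', (k, q, q', op) ∈ rules → Op.rel op w w' →
        ⟨stepSym k, [s q, el w, s q', el w']⟩ ∈ C := by
  obtain ⟨s, hs, -⟩ := hC _ List.mem_cons_self (fun _ => .null 0) (by simp [rootTGD])
  have hroot := hs (nodeAtom m m) (by simp [rootTGD])
  rw [nodeAtom_inst] at hroot
  let Node : Term → Prop := fun x => ⟨nodeSym m, (List.range m).map s ++ [x]⟩ ∈ C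
  have hchild : ∀ a x, Node x → ∃ y, Node y ∧ ⟨consSym a, [x, y]⟩ ∈ C ∧
      ∀ k q q' op, (k, q, q', op) ∈ rules →
        (op = .same (some a) → ⟨stepSym k, [s q, y, s q', y]⟩ ∈ C) ∧
        (op = .push a → ⟨stepSym k, [s q, x, s q', y]⟩ ∈ C) ∧
        (op = .pop a → ⟨stepSym k, [s q, y, s q', x]⟩ ∈ C) := by
    intro a x hx
    let g : ℕ → Term := fun i => if i < m then s i else x
    have hg : (List.range m).map g = (List.range m).map s :=
      List.map_congr_left fun i hi => if_pos (List.mem_range.1 hi)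
    have hgm : g m = x := if_neg (lt_irrefl m)
    obtain ⟨h, hh, hfr⟩ := hC (childTGD rules a)
      (List.mem_cons_of_mem _ (List.mem_map_of_mem (List.mem_finRange a))) g (by
        intro b hb
        obtain rfl := List.mem_singleton.1 hb
        rw [nodeAtom_inst, hg, hgm]
        exact hx)
    have hlt : ∀ i, i < m → h i = s i := fun i hi => by
      rw [hfr i (List.mem_range.2 (by omega))]; exact if_pos hi
    have hm : h m = x := by rw [hfr m (List.mem_range.2 (by omega)), hgm]
    have hmap : (List.range m).map h = (List.range m).map s :=
      List.map_congr_left fun i hi => hlt i (List.mem_range.1 hi)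
    refine ⟨h (m + 1), ?_, ?_, ?_⟩
    · have := hh (nodeAtom m (m + 1)) (by simp [childTGD])
      rwa [nodeAtom_inst, hmap] at this
    · have := hh ⟨consSym a, [m, m + 1]⟩ (by simp [childTGD])
      simpa only [Atom.inst, List.map, hm] using this
    · intro k q q' op hr
      have key : ∀ b ∈ ruleAtoms (some a) m (m + 1) (k, q, q', op), b.inst h ∈ C := fun b hb =>
        hh b (List.mem_cons_of_mem _ (List.mem_cons_of_mem _ (List.mem_flatMap.2 ⟨_, hr, hb⟩)))
      refine ⟨?_, ?_, ?_⟩ <;> rintro rfl <;>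
        simpa [ruleAtoms, Atom.inst, hm, hlt] using key
  choose! nxt hN hP hS using hchild
  let el : List (Fin 4) → Term := fun w => List.rec (s m) (fun a _ y => nxt a y) w
  have hnode : ∀ w, Node (el w) := by
    intro w
    induction w with
    | nil => exact hroot
    | cons a w ih => exact hN a _ ih
  refine ⟨s, el, ?_, ?_, fun a w => hP a _ (hnode w), ?_⟩
  · simpa [Atom.inst] using hs ⟨startSym, [q₀]⟩ (by simp [rootTGD])
  · simpa [Atom.inst] using hs ⟨emptySym, [m]⟩ (by simp [rootTGD])
  · intro k q q' op w w' hr ho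
    cases op with
    | same o =>
      obtain ⟨rfl, ho⟩ := ho
      cases w' with
      | nil =>
        simp only [List.head?_nil] at ho
        subst ho
        have := hs ⟨stepSym k, [q, m, q', m]⟩ (by
          refine List.mem_cons_of_mem _ (List.mem_cons_of_mem _ (List.mem_cons_of_mem _
            (List.mem_flatMap.2 ⟨_, hr, ?_⟩)))
          simp [ruleAtoms])
        simpa [Atom.inst] using this
      | cons a w =>
        exact (hS a _ (hnode w) k q q' _ hr).1 (by rw [← ho]; rfl)
    | push a =>
      obtain rfl := ho
      exact (hS a _ (hnode w) k q q' _ hr).2.1 rfl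
    | pop a =>
      obtain rfl := ho
      exact (hS a _ (hnode w') k q q' _ hr).2.2 rfl

/-! ### Hom-conservativity expresses the existence of an infinite run -/

theorem homConservative_nil_iff {T1 T2 : List TGD} {S : Schema} :
    HomConservative T1 T2 {r | r ∈ ([] : List RelSym)} S ↔
      HomTo S (chase T2 ∅) (chase T1 ∅) := by
  refine ⟨fun h => h ∅ ⟨⟨Set.finite_empty, fun f hf => hf.elim⟩, fun f hf => hf.elim⟩, ?_⟩
  intro h D hD
  obtain rfl : D = ∅ := Set.eq_empty_of_forall_notMem fun f hf => List.not_mem_nil (hD.2 f hf)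
  exact h

theorem mem_querySchema_start : startSym ∈ querySchema := mem_querySchema.2 (Or.inl rfl)

theorem mem_querySchema_empty : emptySym ∈ querySchema := mem_querySchema.2 (Or.inr (Or.inl rfl))

theorem mem_querySchema_step (k : Fin 4) : stepSym k ∈ querySchema :=
  mem_querySchema.2 (Or.inr (Or.inr (Or.inl ⟨k, rfl⟩)))

theorem mem_querySchema_cons (a : Fin 4) : consSym a ∈ querySchema :=
  mem_querySchema.2 (Or.inr (Or.inr (Or.inr ⟨a, rfl⟩)))

/-- The fact representing a configuration, given representations of states and stacks. -/
def runFct (s : ℕ → Term) (el : List (Fin 4) → Term) (d : Config m) : Fct :=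
  ⟨runSym, [s d.1, el (d.2 0), el (d.2 1), el (d.2 2), el (d.2 3)]⟩

theorem drop_eq_getD_cons {w : List (Fin 4)} {j : ℕ} (hj : j < w.length) :
    w.drop j = w.getD j 0 :: w.drop (j + 1) := by
  rw [List.drop_eq_getElem_cons hj, List.getD_eq_getElem _ _ hj]

/-- An infinite run turns a model of the tree TGDs into a model of the run TGDs. -/
theorem isModel_union_run {rules : List (Rule m)} {q₀ : Fin m} {w : List (Fin 4)} {C : Inst}
    {s : ℕ → Term} {el : List (Fin 4) → Term} {X : Set (Config m)}
    (hstart : ⟨startSym, [s q₀]⟩ ∈ C) (hempty : ⟨emptySym, [el []]⟩ ∈ C)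
    (hcons : ∀ a w, ⟨consSym a, [el w, el (a :: w)]⟩ ∈ C)
    (hstep : ∀ k q q' op w w', (k, q, q', op) ∈ rules → Op.rel op w w' →
      ⟨stepSym k, [s q, el w, s q', el w']⟩ ∈ C)
    (hX₀ : (q₀, initStacks w) ∈ X) (hX : ∀ d ∈ X, ∃ d' ∈ X, Step rules d d') :
    IsModel (restrS C {r | r ∈ querySchema} ∪ runFct s el '' X) (runTGDs w) := by
  intro t ht
  simp only [runTGDs, List.mem_cons, List.not_mem_nil, or_false] at ht
  rcases ht with rfl | rfl <;> intro g hg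
  · refine ⟨fun i => if i = 0 then s q₀ else el (w.drop (i - 1)), ?_, by simp [loadTGD]⟩
    intro a ha
    simp only [loadTGD, List.mem_cons, List.mem_map, List.mem_range] at ha
    rcases ha with rfl | rfl | rfl | ⟨j, hj, rfl⟩
    · exact Or.inl ⟨by simpa [Atom.inst] using hstart, mem_querySchema_start⟩
    · exact Or.inl ⟨by simpa [Atom.inst] using hempty, mem_querySchema_empty⟩
    · exact Or.inr ⟨_, hX₀, by simp [runFct, Atom.inst, initStacks]⟩
    · refine Or.inl ⟨?_, mem_querySchema_cons _⟩
      have := hcons (w.getD j 0) (w.drop (j + 1))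
      rw [← drop_eq_getD_cons hj] at this
      simpa [Atom.inst, letterAtom] using this
  · rcases hg ⟨runSym, [0, 1, 2, 3, 4]⟩ (by simp [moveTGD]) with h | ⟨d, hd, h⟩
    · exact absurd h.2 runSym_notMem
    obtain ⟨d', hd', hdd'⟩ := hX d hd
    simp only [runFct, Atom.inst, List.map, Fct.mk.injEq, true_and, List.cons.injEq,
      and_true] at h
    obtain ⟨h0, h1, h2, h3, h4⟩ := h
    refine ⟨fun i => [s d.1, el (d.2 0), el (d.2 1), el (d.2 2), el (d.2 3),
      s d'.1, el (d'.2 0), el (d'.2 1), el (d'.2 2), el (d'.2 3)].getD i (s 0), ?_, ?_⟩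
    · intro a ha
      simp only [moveTGD, List.mem_cons, List.mem_map] at ha
      rcases ha with rfl | ⟨k, -, rfl⟩
      · exact Or.inr ⟨_, hd', by simp [runFct, Atom.inst]⟩
      · refine Or.inl ⟨?_, mem_querySchema_step _⟩
        obtain ⟨op, hr, ho⟩ := hdd' k
        have := hstep _ _ _ _ _ _ hr ho
        fin_cases k <;> exact this
    · intro x hx
      rw [show moveTGD.frontier = List.range 5 from rfl, List.mem_range] at hx
      interval_cases x <;> assumption

/-- A homomorphism from a model of the run TGDs to the canonical model of the tree TGDs describes
an infinite run. -/
theorem hasInfiniteRun_of_isHomOn {rules : List (Rule m)} {q₀ : Fin m} {w : List (Fin 4)}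
    {C : Inst} (hC : IsModel C (runTGDs w)) {χ : Term → Term}
    (hχ : IsHomOn {r | r ∈ querySchema} χ C (treeModel rules q₀)) :
    HasInfiniteRun rules (q₀, initStacks w) := by
  refine ⟨{d | ∃ (t : Term) (x : Fin 4 → Term), ⟨runSym, [t, x 0, x 1, x 2, x 3]⟩ ∈ C ∧
    χ t = .const d.1 ∧ ∀ k, χ (x k) = wordTerm (d.2 k)}, ?_, ?_⟩
  · obtain ⟨h, hh, -⟩ := hC (loadTGD w) (by simp [runTGDs]) (fun _ => .null 0)
      (by simp [loadTGD])
    have hstart := hχ _ (hh ⟨startSym, [0]⟩ (by simp [loadTGD])) mem_querySchema_start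
    have hempty := hχ _ (hh ⟨emptySym, [w.length + 1]⟩ (by simp [loadTGD])) mem_querySchema_empty
    have hrun := hh ⟨runSym, [0, 1, w.length + 1, w.length + 1, w.length + 1]⟩ (by simp [loadTGD])
    have hstart' : χ (h 0) = .const q₀ := by
      simpa [Atom.inst] using start_mem_treeModel.1 hstart
    have hempty' : χ (h (w.length + 1)) = wordTerm [] := by
      simpa [Atom.inst] using empty_mem_treeModel.1 hempty
    have hword : ∀ j ≤ w.length, χ (h (w.length - j + 1)) = wordTerm (w.drop (w.length - j)) := by
      intro j
      induction j with
      | zero => simpa using hempty'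
      | succ j ih =>
        intro hj
        have hlt : w.length - (j + 1) < w.length := by omega
        have := hχ _ (hh (letterAtom w (w.length - (j + 1))) (by
          simp only [loadTGD, List.mem_cons, List.mem_map, List.mem_range]
          exact Or.inr (Or.inr (Or.inr ⟨_, hlt, rfl⟩)))) (mem_querySchema_cons _)
        obtain ⟨v, hv⟩ := cons_mem_treeModel.1 this
        simp only [letterAtom, Atom.inst, List.map, List.cons.injEq, and_true] at hv
        rw [show w.length - (j + 1) + 2 = w.length - j + 1 by omega, ih (by omega)] at hv
        rw [hv.2, ← wordTerm_injective hv.1, drop_eq_getD_cons hlt]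
        congr 3
        omega
    refine ⟨h 0, fun k => if k = 0 then h 1 else h (w.length + 1), by simpa [Atom.inst] using hrun,
      hstart', fun k => ?_⟩
    by_cases hk : k = 0
    · simpa [hk, initStacks] using hword w.length le_rfl
    · simpa [hk, initStacks] using hempty'
  · rintro d ⟨t, x, hrun, ht, hx⟩
    obtain ⟨h, hh, hfr⟩ := hC moveTGD (by simp [runTGDs])
      (fun i => [t, x 0, x 1, x 2, x 3].getD i t) (by simpa [moveTGD, Atom.inst] using hrun)
    have h0 : h 0 = t := hfr 0 (by simp [moveTGD])
    have hs : ∀ k : Fin 4, h (k + 1) = x k := fun k => by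
      rw [hfr (k + 1) (List.mem_range.2 (by omega))]
      fin_cases k <;> rfl
    have hstep : ∀ k : Fin 4, ∃ q' op u', (k, d.1, q', op) ∈ rules ∧ Op.rel op (d.2 k) u' ∧
        χ (h 5) = .const (q' : Fin m) ∧ χ (h (k + 6)) = wordTerm u' := by
      intro k
      have := hχ _ (hh ⟨stepSym k, [0, k + 1, 5, k + 6]⟩
        (List.mem_cons_of_mem _ (List.mem_map_of_mem (List.mem_finRange k))))
        (mem_querySchema_step k)
      obtain ⟨q, q', op, u, u', hr, ho, he⟩ := step_mem_treeModel.1 this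
      simp only [Atom.inst, List.map, List.cons.injEq, and_true, h0, hs, ht, hx] at he
      obtain ⟨e1, e2, e3, e4⟩ := he
      obtain rfl := Fin.ext (Term.const.inj e1)
      obtain rfl := wordTerm_injective e2
      exact ⟨q', op, u', hr, ho, e3, e4⟩
    choose q' op S' hr ho hq hS using hstep
    have hq' : ∀ k, q' k = q' 0 := fun k =>
      Fin.ext (Term.const.inj ((hq k).symm.trans (hq 0)))
    refine ⟨(q' 0, S'), ⟨h 5, fun k => h (k + 6), ?_, hq 0, hS⟩, fun k =>
      ⟨op k, hq' k ▸ hr k, ho k⟩⟩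
    simpa [moveTGD, Atom.inst] using hh ⟨runSym, [5, 6, 7, 8, 9]⟩ (by simp [moveTGD])

theorem homConservative_iff (rules : List (Rule m)) (q₀ : Fin m) (w : List (Fin 4)) :
    HomConservative (treeTGDs rules q₀) (runTGDs w) {r | r ∈ ([] : List RelSym)}
      {r | r ∈ querySchema} ↔ HasInfiniteRun rules (q₀, initStacks w) := by
  have h1 := chase_isChaseResult (treeTGDs rules q₀) Set.finite_empty
  have h2 := chase_isChaseResult (runTGDs w) Set.finite_empty
  rw [homConservative_nil_iff]
  constructor
  · rintro ⟨φ, -, hφ⟩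
    obtain ⟨ψ, -, hψ⟩ := h1.exists_hom (fun t ht => (treeTGDs_wf rules q₀ t ht).1)
      (treeModel_isModel rules q₀) (Set.empty_subset _)
    refine hasInfiniteRun_of_isHomOn h2.isModel (χ := ψ ∘ φ) fun f hf hr => ?_
    have := hψ _ (hφ f hf hr)
    rwa [Fct.map, Fct.map, List.map_map] at this
  · rintro ⟨X, hX₀, hX⟩
    obtain ⟨s, el, hs, he, hc, hst⟩ := exists_tree h1.isModel
    obtain ⟨φ, hφ, hφ'⟩ := h2.exists_hom (fun t ht => (runTGDs_wf w t ht).1)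
      (isModel_union_run hs he hc hst hX₀ hX) (Set.empty_subset _)
    refine ⟨φ, hφ, fun f hf hr => ?_⟩
    rcases hφ' f hf with h | ⟨d, -, h⟩
    · exact h.1
    · have : f.rel = runSym := (congrArg Fct.rel h).symm
      exact absurd (this ▸ hr) runSym_notMem
/-! ### Simulating multi-stack machines -/

section Machine

open Turing TM2 Function

variable {K Γ Λ σ : Type}

/-- Machine statements over a uniform stack alphabet. -/
abbrev MStmt (K Γ Λ σ : Type) : Type := TM2.Stmt (fun _ : K => Γ) Λ σ

theorem exists_same_rel {w w' : List Γ} :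
    (∃ op : Op Γ, (∃ o, op = .same o) ∧ op.rel w w') ↔ w' = w :=
  ⟨by rintro ⟨_, ⟨o, rfl⟩, h, -⟩; exact h, fun h => ⟨_, ⟨_, rfl⟩, h, rfl⟩⟩

theorem forall_exists_same_rel {S S' : K → List Γ} :
    (∀ k, ∃ op : Op Γ, (∃ o, op = .same o) ∧ op.rel (S k) (S' k)) ↔ S' = S := by
  simp only [exists_same_rel, funext_iff]

variable [DecidableEq K]

/-- Executing a single instruction of a machine. -/
def next (M : Λ → MStmt K Γ Λ σ) : MStmt K Γ Λ σ → σ → (K → List Γ) →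
    Option ((MStmt K Γ Λ σ × σ) × (K → List Γ))
  | .push k f q, v, S => some ((q, v), update S k (f v :: S k))
  | .peek k f q, v, S => some ((q, f v (S k).head?), S)
  | .pop k f q, v, S => some ((q, f v (S k).head?), update S k (S k).tail)
  | .load a q, v, S => some ((q, a v), S)
  | .branch f q₁ q₂, v, S => some ((cond (f v) q₁ q₂, v), S)
  | .goto l, v, S => some ((M (l v), v), S)
  | .halt, _, _ => none

/-- The operations admitted on stack `k` when executing a single instruction. -/
def Admits (M : Λ → MStmt K Γ Λ σ) (k : K) : MStmt K Γ Λ σ → σ → MStmt K Γ Λ σ × σ → Op Γ → Prop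
  | .push k' f q, v, p, op => p = (q, v) ∧ if k = k' then op = .push (f v) else ∃ o, op = .same o
  | .peek k' f q, v, p, op => p.1 = q ∧ ∃ o, op = .same o ∧ (k = k' → p.2 = f v o)
  | .pop k' f q, v, p, op => p.1 = q ∧ if k = k' then
      (∃ a, op = .pop a ∧ p.2 = f v (some a)) ∨ op = .same none ∧ p.2 = f v none
      else ∃ o, op = .same o
  | .load a q, v, p, op => p = (q, a v) ∧ ∃ o, op = .same o
  | .branch f q₁ q₂, v, p, op => p = (cond (f v) q₁ q₂, v) ∧ ∃ o, op = .same o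
  | .goto l, v, p, op => p = (M (l v), v) ∧ ∃ o, op = .same o
  | .halt, _, _, _ => False

theorem next_eq_some_iff [Nonempty K] (M : Λ → MStmt K Γ Λ σ) (q : MStmt K Γ Λ σ) (v : σ)
    (S : K → List Γ) (p : MStmt K Γ Λ σ × σ) (S' : K → List Γ) :
    next M q v S = some (p, S') ↔ ∀ k, ∃ op, Admits M k q v p op ∧ op.rel (S k) (S' k) := by
  cases q with
  | push k' f q =>
    simp only [next, Admits, Option.some.injEq, Prod.mk.injEq]
    constructor
    · rintro ⟨rfl, rfl⟩ k
      by_cases hk : k = k'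
      · subst hk
        exact ⟨.push (f v), by simp, by simp [Op.rel]⟩
      · exact ⟨.same (S k).head?, by simp [hk], by simp [Op.rel, hk]⟩
    · intro h
      refine ⟨(h k').choose_spec.1.1.symm, funext fun k => ?_⟩
      obtain ⟨op, ⟨-, h1⟩, h2⟩ := h k
      by_cases hk : k = k'
      · subst hk
        simp only [if_true] at h1
        subst h1
        simpa [Op.rel, eq_comm] using h2
      · rw [if_neg hk] at h1
        obtain ⟨o, rfl⟩ := h1
        simpa [hk] using h2.1.symm
  | peek k' f q =>
    simp only [next, Admits, Option.some.injEq, Prod.mk.injEq]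
    constructor
    · rintro ⟨rfl, rfl⟩ k
      exact ⟨.same (S k).head?, ⟨rfl, _, rfl, fun hk => by rw [hk]⟩, by simp [Op.rel]⟩
    · intro h
      obtain ⟨op, ⟨h0, o, rfl, h1⟩, h2⟩ := h k'
      refine ⟨Prod.ext h0.symm ?_, funext fun k => ?_⟩
      · rw [h1 rfl, ← h2.2]
      · obtain ⟨op, ⟨-, o, rfl, -⟩, h2⟩ := h k
        exact h2.1.symm
  | pop k' f q =>
    simp only [next, Admits, Option.some.injEq, Prod.mk.injEq]
    constructor
    · rintro ⟨rfl, rfl⟩ k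
      by_cases hk : k = k'
      · subst hk
        cases hS : S k with
        | nil => exact ⟨.same none, by simp, by simp [Op.rel]⟩
        | cons a l => exact ⟨.pop a, by simp, by simp [Op.rel]⟩
      · exact ⟨.same (S k).head?, by simp [hk], by simp [Op.rel, hk]⟩
    · intro h
      have key : p.2 = f v (S k').head? ∧ S' k' = (S k').tail := by
        obtain ⟨op, ⟨-, h1⟩, h2⟩ := h k'
        rw [if_pos rfl] at h1
        rcases h1 with ⟨a, rfl, h1⟩ | ⟨rfl, h1⟩
        · rw [h1, show S k' = a :: S' k' from h2]
          exact ⟨rfl, rfl⟩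
        · rw [h1, h2.2, h2.1, List.head?_eq_none_iff.1 h2.2]
          exact ⟨rfl, rfl⟩
      refine ⟨Prod.ext (h k').choose_spec.1.1.symm key.1.symm, funext fun k => ?_⟩
      by_cases hk : k = k'
      · subst hk
        rw [update_self, key.2]
      · obtain ⟨op, ⟨-, h1⟩, h2⟩ := h k
        rw [if_neg hk] at h1
        obtain ⟨o, rfl⟩ := h1
        simpa [hk] using h2.1.symm
  | halt => simp [next, Admits]
  | load a q =>
    simp only [next, Admits, Option.some.injEq, Prod.mk.injEq, and_assoc, exists_and_left,
      forall_and, forall_const, forall_exists_same_rel, eq_comm (a := p), eq_comm (a := S)]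
  | branch f q₁ q₂ =>
    simp only [next, Admits, Option.some.injEq, Prod.mk.injEq, and_assoc, exists_and_left,
      forall_and, forall_const, forall_exists_same_rel, eq_comm (a := p), eq_comm (a := S)]
  | goto l =>
    simp only [next, Admits, Option.some.injEq, Prod.mk.injEq, and_assoc, exists_and_left,
      forall_and, forall_const, forall_exists_same_rel, eq_comm (a := p), eq_comm (a := S)]

/-- The machine `M` halts when continuing with the statement `p.1` in state `p.2` on stacks `S`. -/
def Halts (M : Λ → MStmt K Γ Λ σ) (p : MStmt K Γ Λ σ × σ) (S : K → List Γ) : Prop :=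
  (StateTransition.eval (TM2.step M) (TM2.stepAux p.1 p.2 S)).Dom

theorem exists_next_of_not_halts {M : Λ → MStmt K Γ Λ σ} {p : MStmt K Γ Λ σ × σ} {S : K → List Γ}
    (h : ¬ Halts M p S) : ∃ p' S', next M p.1 p.2 S = some (p', S') ∧ ¬ Halts M p' S' := by
  obtain ⟨q, v⟩ := p
  cases q with
  | halt =>
    exact absurd (Part.dom_iff_mem.2 ⟨_, StateTransition.mem_eval.2 ⟨.refl, rfl⟩⟩) h
  | goto l =>
    refine ⟨_, _, rfl, ?_⟩
    have : StateTransition.Reaches (TM2.step M) (TM2.stepAux (.goto l) v S)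
        (TM2.stepAux (M (l v)) v S) := .single rfl
    rwa [Halts, StateTransition.reaches_eval this] at h
  | branch f q₁ q₂ =>
    refine ⟨_, _, rfl, ?_⟩
    revert h
    simp only [Halts, stepAux]
    cases f v <;> exact id
  | _ => exact ⟨_, _, rfl, h⟩

theorem not_halts_of_forall_next {M : Λ → MStmt K Γ Λ σ}
    {X : Set ((MStmt K Γ Λ σ × σ) × (K → List Γ))}
    (hX : ∀ d ∈ X, ∃ d' ∈ X, next M d.1.1 d.1.2 d.2 = some d') {d} (hd : d ∈ X) :
    ¬ Halts M d.1 d.2 := by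
  intro h
  obtain ⟨b, hb⟩ := Part.dom_iff_mem.1 h
  suffices H : ∀ q v S, TM2.stepAux q v S = TM2.stepAux d.1.1 d.1.2 d.2 → ((q, v), S) ∉ X from
    H _ _ _ rfl hd
  clear hd h
  refine StateTransition.evalInduction (C := fun a => ∀ q v S, TM2.stepAux q v S = a →
    ((q, v), S) ∉ X) hb fun a _ ih q => ?_
  clear hb
  induction q with
  | halt =>
    intro v S _ hm
    obtain ⟨d', -, h⟩ := hX _ hm
    cases h
  | goto l =>
    rintro v S rfl hm
    obtain ⟨d', hd', h⟩ := hX _ hm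
    cases h
    exact ih _ rfl _ _ _ rfl hd'
  | branch f q₁ q₂ ih₁ ih₂ =>
    rintro v S rfl hm
    obtain ⟨d', hd', h⟩ := hX _ hm
    cases h
    simp only [stepAux] at ih₁ ih₂
    cases hf : f v <;> simp only [hf, cond_true, cond_false] at hd' ih₁ ih₂
    · exact ih₂ _ _ rfl hd'
    · exact ih₁ _ _ rfl hd'
  | load _ _ ih' | _ _ _ _ ih' =>
    rintro v S rfl hm
    obtain ⟨d', hd', h⟩ := hX _ hm
    cases h
    exact ih' _ _ rfl hd'

end Machine
section Simulation

variable {Γ Δ : Type}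

def Op.map (f : Γ → Δ) : Op Γ → Op Δ
  | .same o => .same (o.map f)
  | .push a => .push (f a)
  | .pop a => .pop (f a)

theorem Op.map_map (g : Δ → Γ) (f : Γ → Δ) (h : ∀ a, g (f a) = a) (op : Op Γ) :
    (op.map f).map g = op := by
  cases op <;> simp [Op.map, Function.comp_def, h]

theorem Op.rel_map {f : Γ → Δ} (hf : Function.Injective f) (op : Op Γ) (w w' : List Γ) :
    (op.map f).rel (w.map f) (w'.map f) ↔ op.rel w w' := by
  have hf' := List.map_injective_iff.2 hf
  cases op with
  | same o => simp [Op.map, Op.rel, hf'.eq_iff, (Option.map_injective hf).eq_iff]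
  | push a => simp [Op.map, Op.rel, ← List.map_cons, hf'.eq_iff]
  | pop a => simp [Op.map, Op.rel, ← List.map_cons, hf'.eq_iff]

instance [Finite Γ] : Finite (Op Γ) :=
  Finite.of_surjective (Sum.elim Op.same (Sum.elim Op.push Op.pop) :
    Option Γ ⊕ Γ ⊕ Γ → Op Γ) fun op => by
      cases op with
      | same o => exact ⟨.inl o, rfl⟩
      | push a => exact ⟨.inr (.inl a), rfl⟩
      | pop a => exact ⟨.inr (.inr a), rfl⟩

variable {K Λ σ : Type} [DecidableEq K]

/-- A machine with four stacks and four letters and finitely many reachable control states can be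
simulated by a stack system. -/
theorem exists_rules (M : Λ → MStmt K Γ Λ σ) {A : Set (MStmt K Γ Λ σ × σ)} (hA : A.Finite)
    (hnext : ∀ p ∈ A, ∀ S p' S', next M p.1 p.2 S = some (p', S') → p' ∈ A)
    (eK : Fin 4 ≃ K) (eΓ : Γ ≃ Fin 4) {p₀ : MStmt K Γ Λ σ × σ} (hp₀ : p₀ ∈ A) :
    ∃ (m : ℕ) (rules : List (Rule m)) (q₀ : Fin m), ∀ S : K → List Γ,
      HasInfiniteRun rules (q₀, fun k => (S (eK k)).map eΓ) ↔ ¬ Halts M p₀ S := by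
  have : Finite A := hA.to_subtype
  have : Nonempty K := ⟨eK 0⟩
  let e := Finite.equivFin A
  let R : Set (Rule (Nat.card A)) := {r | Admits M (eK r.1) (e.symm r.2.1).1.1 (e.symm r.2.1).1.2
    (e.symm r.2.2.1).1 (r.2.2.2.map eΓ.symm)}
  have hR : R.Finite := Set.toFinite R
  let F : Config (Nat.card A) → (MStmt K Γ Λ σ × σ) × (K → List Γ) := fun c =>
    ((e.symm c.1).1, fun k => (c.2 (eK.symm k)).map eΓ.symm)
  have hF : ∀ p (hp : p ∈ A) (S : K → List Γ),
      F (e ⟨p, hp⟩, fun k => (S (eK k)).map eΓ) = (p, S) := by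
    intro p hp S
    exact Prod.ext (congrArg Subtype.val (e.symm_apply_apply _)) (by simp [F, Function.comp_def])
  have hstep : ∀ c c', Step hR.toFinset.toList c c' ↔
      next M (F c).1.1 (F c).1.2 (F c).2 = some (F c') := by
    intro c c'
    rw [show F c' = ((F c').1, (F c').2) from rfl, next_eq_some_iff]
    refine eK.forall_congr fun k => ?_
    simp only [Finset.mem_toList, Set.Finite.mem_toFinset, F, eK.symm_apply_apply]
    constructor
    · rintro ⟨op, h1, h2⟩
      exact ⟨_, h1, (Op.rel_map eΓ.symm.injective _ _ _).2 h2⟩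
    · rintro ⟨op, h1, h2⟩
      have hop := Op.map_map _ _ eΓ.symm_apply_apply op
      refine ⟨op.map eΓ, ?_, ?_⟩
      · rwa [← hop] at h1
      · rwa [← hop, Op.rel_map eΓ.symm.injective] at h2
  refine ⟨_, hR.toFinset.toList, e ⟨p₀, hp₀⟩, fun S => ?_⟩
  constructor
  · rintro ⟨X, hX₀, hX⟩
    refine not_halts_of_forall_next (X := F '' X) (d := (p₀, S)) ?_ ⟨_, hX₀, hF _ _ _⟩
    rintro _ ⟨c, hc, rfl⟩
    obtain ⟨c', hc', h⟩ := hX c hc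
    exact ⟨_, ⟨c', hc', rfl⟩, (hstep _ _).1 h⟩
  · intro h
    refine ⟨{c | ¬ Halts M (F c).1 (F c).2}, by rwa [Set.mem_ofPred_eq, hF], fun c hc => ?_⟩
    obtain ⟨p', S', h1, h2⟩ := exists_next_of_not_halts hc
    have hp' := hnext _ (e.symm c.1).2 _ _ _ h1
    refine ⟨(e ⟨p', hp'⟩, fun k => (S' (eK k)).map eΓ), ?_, (hstep _ _).2 ?_⟩
    · rwa [Set.mem_ofPred_eq, hF]
    · rwa [hF]

open Turing TM2 in
/-- The control states reachable from a supporting set of labels. -/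
theorem next_mem_stmts {M : Λ → MStmt K Γ Λ σ} {L : Finset Λ}
    (hL : ∀ l ∈ L, SupportsStmt L (M l)) {p p' : MStmt K Γ Λ σ × σ} {S S' : K → List Γ}
    (hp : ∃ l ∈ L, p.1 ∈ stmts₁ (M l)) (h : next M p.1 p.2 S = some (p', S')) :
    ∃ l ∈ L, p'.1 ∈ stmts₁ (M l) := by
  classical
  obtain ⟨l, hl, hp⟩ := hp
  obtain ⟨q, v⟩ := p
  cases q with
  | goto f =>
    cases h
    exact ⟨f v, stmts₁_supportsStmt_mono hp (hL l hl) v, stmts₁_self⟩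
  | halt => cases h
  | branch f q₁ q₂ =>
    cases h
    refine ⟨l, hl, stmts₁_trans hp ?_⟩
    rw [stmts₁]
    cases f v
    · exact Finset.mem_insert_of_mem (Finset.mem_union_right _ stmts₁_self)
    · exact Finset.mem_insert_of_mem (Finset.mem_union_left _ stmts₁_self)
  | _ =>
    cases h
    refine ⟨l, hl, stmts₁_trans hp ?_⟩
    rw [stmts₁]
    exact Finset.mem_insert_of_mem stmts₁_self

end Simulation

section PartialRecursive

open Turing PartrecToTM2

def letterEquiv : Γ' ≃ Fin 4 where
  toFun a := match a with
    | .consₗ => 0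
    | .cons => 1
    | .bit0 => 2
    | .bit1 => 3
  invFun i := match i with
    | 0 => .consₗ
    | 1 => .cons
    | 2 => .bit0
    | 3 => .bit1
  left_inv a := by cases a <;> rfl
  right_inv i := by fin_cases i <;> rfl

def stackEquiv : Fin 4 ≃ K' where
  toFun i := match i with
    | 0 => .main
    | 1 => .rev
    | 2 => .aux
    | 3 => .stack
  invFun k := match k with
    | .main => 0
    | .rev => 1
    | .aux => 2
    | .stack => 3
  left_inv i := by fin_cases i <;> rfl
  right_inv k := by cases k <;> rfl

/-- Non-termination of a partial recursive function is the existence of an infinite run of a stack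
system. -/
theorem exists_rules_code (c : ToPartrec.Code) :
    ∃ (m : ℕ) (rules : List (Rule m)) (q₀ : Fin m), ∀ n : ℕ,
      HasInfiniteRun rules (q₀, initStacks ((trList [n]).map letterEquiv)) ↔
        ¬ (c.eval [n]).Dom := by
  classical
  have hsupp := (tr_supports c .halt).2
  have h₀ : trNormal c .halt ∈ codeSupp c .halt := codeSupp_self _ _ (trStmts₁_self _)
  let A : Set (MStmt K' Γ' Λ' (Option Γ') × Option Γ') :=
    {p | ∃ l ∈ codeSupp c .halt, p.1 ∈ TM2.stmts₁ (tr l)}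
  have hA : A.Finite := by
    refine (((codeSupp c .halt).biUnion fun l => TM2.stmts₁ (tr l)).finite_toSet.prod
      (Set.finite_univ (α := Option Γ'))).subset fun p hp => ⟨?_, trivial⟩
    simpa [A] using hp
  obtain ⟨m, rules, q₀, h⟩ := exists_rules (K := K') (Γ := Γ') tr hA
    (fun p hp S p' S' => next_mem_stmts hsupp hp) stackEquiv letterEquiv
    (p₀ := (tr (trNormal c .halt), none)) ⟨_, h₀, TM2.stmts₁_self⟩
  refine ⟨m, rules, q₀, fun n => ?_⟩
  have hS : initStacks ((trList [n]).map letterEquiv) =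
      fun k => (K'.elim (trList [n]) [] [] [] (stackEquiv k)).map letterEquiv := by
    funext k
    fin_cases k <;> rfl
  rw [hS, h, not_iff_not]
  have hreach : StateTransition.Reaches (TM2.step tr) (init c [n])
      (TM2.stepAux (tr (trNormal c .halt)) none (K'.elim (trList [n]) [] [] [])) := .single rfl
  change (StateTransition.eval (TM2.step tr) (TM2.stepAux (tr (trNormal c .halt)) none
    (K'.elim (trList [n]) [] [] []))).Dom ↔ _
  rw [← StateTransition.reaches_eval hreach, tr_eval]
  rfl

end PartialRecursive
/-! ### The reduction is computable -/

section Computability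

open Turing.PartrecToTM2

/-- The encoding of a natural number on the first stack. -/
def numberWord (n : ℕ) : List (Fin 4) := (trList [n]).map letterEquiv

theorem trNat_eq_cons {n : ℕ} (hn : n ≠ 0) :
    trNat n = (if n % 2 = 0 then Γ'.bit0 else Γ'.bit1) :: trNat (n / 2) := by
  obtain ⟨p, rfl⟩ : ∃ p : PosNum, n = p := by
    have h := Num.to_of_nat n
    cases hp : (n : Num) with
    | zero => rw [hp] at h; exact absurd h.symm hn
    | pos p => rw [hp] at h; exact ⟨p, h.symm⟩
  have htr : ∀ p : PosNum, trNat p = trPosNum p := fun p =>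
    congrArg trNum (Num.of_to_nat (.pos p))
  rw [htr]
  cases p with
  | one => rfl
  | bit0 p =>
    rw [PosNum.cast_bit0, if_pos (by omega), show ((p : ℕ) + p) / 2 = p by omega, htr]
    rfl
  | bit1 p =>
    rw [PosNum.cast_bit1, if_neg (by omega), show ((p : ℕ) + p + 1) / 2 = p by omega, htr]
    rfl

theorem primrec_numberWord : Primrec numberWord := by
  let bits : ℕ → List (Fin 4) := fun n => (trNat n).map letterEquiv
  have hbits : Primrec bits := by
    have hg : Primrec₂ fun (_ : Unit) (l : List (List (Fin 4))) =>
        if l.length = 0 then some [] else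
          l[l.length / 2]?.map fun t => (if l.length % 2 = 0 then (2 : Fin 4) else 3) :: t := by
      have hl : Primrec fun p : Unit × List (List (Fin 4)) => p.2.length :=
        Primrec.list_length.comp Primrec.snd
      refine Primrec.ite (Primrec.eq.comp hl (Primrec.const 0)) (Primrec.const _) ?_
      refine Primrec.option_map (Primrec.list_getElem?.comp Primrec.snd
        (Primrec.nat_div.comp hl (Primrec.const 2))) ?_
      refine Primrec.list_cons.comp (Primrec.ite (Primrec.eq.comp (Primrec.nat_mod.comp
        (hl.comp Primrec.fst) (Primrec.const 2)) (Primrec.const 0)) (Primrec.const _)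
        (Primrec.const _)) Primrec.snd
    refine (Primrec.nat_strong_rec (fun _ : Unit => bits) hg fun _ n => ?_).comp
      (Primrec.const ()) Primrec.id
    rcases eq_or_ne n 0 with rfl | hn
    · rfl
    · have hlt : n / 2 < n := by omega
      simp only [List.length_map, List.length_range, hn, if_false, List.getElem?_map,
        List.getElem?_range hlt, Option.map_some, bits, trNat_eq_cons hn, List.map_cons]
      split_ifs <;> rfl
  refine (Primrec.list_append.comp hbits (Primrec.const [1])).of_eq fun n => ?_
  simp [numberWord, trList, bits]
  rfl

theorem primrec_atom {α : Type} [Primcodable α] {r : α → RelSym} {l : α → List ℕ}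
    (hr : Primrec r) (hl : Primrec l) : Primrec fun a => (⟨r a, l a⟩ : Atom) :=
  (Primrec.of_equiv_symm (e := atomEquiv)).comp (hr.pair hl)

theorem primrec_loadTGD : Primrec loadTGD := by
  have hlen : Primrec fun w : List (Fin 4) => w.length + 1 :=
    Primrec.succ.comp Primrec.list_length
  have hcons : Primrec consSym :=
    (Primrec.of_equiv_symm (e := relSymEquiv)).comp
      ((Primrec.nat_add.comp (Primrec.const 7) Primrec.fin_val).pair (Primrec.const 2))
  have hletter : Primrec₂ letterAtom :=
    primrec_atom (hcons.comp (Primrec.list_getD 0))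
      (Primrec.list_cons.comp (Primrec.nat_add.comp Primrec.snd (Primrec.const 2))
        (Primrec.list_cons.comp (Primrec.succ.comp Primrec.snd) (Primrec.const [])))
  have hrun : Primrec fun w : List (Fin 4) =>
      [0, 1, w.length + 1, w.length + 1, w.length + 1] :=
    Primrec.list_cons.comp (Primrec.const 0) (Primrec.list_cons.comp (Primrec.const 1)
      (Primrec.list_cons.comp hlen (Primrec.list_cons.comp hlen
        (Primrec.list_cons.comp hlen (Primrec.const [])))))
  have hhead : Primrec fun w => (loadTGD w).head :=
    Primrec.list_cons.comp (Primrec.const _) (Primrec.list_cons.comp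
      (primrec_atom (Primrec.const _) (Primrec.list_cons.comp hlen (Primrec.const [])))
      (Primrec.list_cons.comp (primrec_atom (Primrec.const _) hrun)
        (Primrec.list_map (Primrec.list_range.comp Primrec.list_length) hletter)))
  exact (Primrec.of_equiv_symm (e := tgdEquiv)).comp
    ((Primrec.const []).pair (hhead.pair (Primrec.const [])))

theorem primrec_runTGDs : Primrec runTGDs :=
  Primrec.list_cons.comp primrec_loadTGD (Primrec.const [moveTGD])

end Computability

/-- The halting problem for partial recursive functions reduces to the termination of a single
function. -/
theorem exists_universal_code : ∃ c : Turing.ToPartrec.Code, ∀ d : Nat.Partrec.Code,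
    (c.eval [Encodable.encode d]).Dom ↔ (d.eval 0).Dom := by
  have hf : Partrec fun n : ℕ => (Denumerable.ofNat Nat.Partrec.Code n).eval 0 :=
    Nat.Partrec.Code.eval_part.comp (Computable.ofNat _) (Computable.const 0)
  obtain ⟨c, hc⟩ := Turing.ToPartrec.Code.exists_code (Nat.Partrec'.part_iff₁.2 hf)
  refine ⟨c, fun d => ?_⟩
  have := hc (Encodable.encode d ::ᵥ List.Vector.nil)
  simp only [List.Vector.head_cons, Denumerable.ofNat_encode] at this
  rw [show c.eval [Encodable.encode d] = _ from this]
  rfl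

end StackSystem

/-- Theorem 1(1): hom-conservativity for linear TGDs is undecidable. -/
theorem hom_conservativity_linear_undecidable :
    ¬ ComputablePred (fun x : List TGD × List TGD × List RelSym × List RelSym =>
        (∀ t ∈ x.1, t.wf ∧ t.Linear) ∧ (∀ t ∈ x.2.1, t.wf ∧ t.Linear) ∧
        HomConservative x.1 x.2.1 { r | r ∈ x.2.2.1 } { r | r ∈ x.2.2.2 }) := by
  intro hP
  obtain ⟨c, hc⟩ := StackSystem.exists_universal_code
  obtain ⟨m, rules, q₀, h⟩ := StackSystem.exists_rules_code c
  refine ComputablePred.halting_problem 0 ?_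
  refine (ComputablePred.computable_of_manyOneReducible
    (p := fun d : Nat.Partrec.Code => ¬ (d.eval 0).Dom) ⟨fun d =>
      (StackSystem.treeTGDs rules q₀,
        StackSystem.runTGDs (StackSystem.numberWord (Encodable.encode d)), [],
        StackSystem.querySchema), ?_, fun d => ?_⟩ hP).not.of_eq fun d => not_not
  · exact (Computable.const _).pair (((StackSystem.primrec_runTGDs.comp
      StackSystem.primrec_numberWord).to_comp.comp Computable.encode).pair (Computable.const _))
  · show ¬ (d.eval 0).Dom ↔ _
    rw [← hc, ← h]
    exact (StackSystem.homConservative_iff rules q₀ _).symm.trans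
      ⟨fun hd => ⟨StackSystem.treeTGDs_wf _ _, StackSystem.runTGDs_wf _, hd⟩, fun hd => hd.2.2⟩
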